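/- arXiv:1811.09650 — 2 statements merged into one kernel-verified Lean document; each statement's English description precedes it below -/
import Mathlib

section
/- The class 𝓥 of all rotating machines is a Fraïssé class of finite structures. -/
open FirstOrder CategoryTheory FirstOrder.Language

/-- The language of rotating machines: two binary relation symbols `<` (coded by `true`)
and `∼` (coded by `false`), and one unary function symbol `s` (the successor). -/
def rotLang : FirstOrder.Language where
  Functions n := match n with
    | 1 => Unit
    | _ => Empty
  Relations n := match n with
    | 2 => Bool
    | _ => Empty

instance (l : ℕ) : Countable (rotLang.Functions l) :=
  match l with
  | 0 => inferInstanceAs (Countable Empty)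
  | 1 => inferInstanceAs (Countable Unit)
  | (_ + 2) => inferInstanceAs (Countable Empty)

/-- The successor operation `s`. -/
def rotS {M : Type} [rotLang.Structure M] (x : M) : M :=
  Structure.funMap (L := rotLang) (n := 1) (() : Unit) ![x]

/-- The strict order relation `<`. -/
def rotLt {M : Type} [rotLang.Structure M] (x y : M) : Prop :=
  Structure.RelMap (L := rotLang) (n := 2) (true : Bool) ![x, y]

/-- The graph relation `∼`. -/
def rotSim {M : Type} [rotLang.Structure M] (x y : M) : Prop :=
  Structure.RelMap (L := rotLang) (n := 2) (false : Bool) ![x, y]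

/-- `x` and `y` lie on the same rotating wheel (the same `s`-orbit). -/
def rotSameWheel {M : Type} [rotLang.Structure M] (x y : M) : Prop :=
  ∃ k : ℕ, rotS^[k] x = y

/-- A rotating machine: a disjoint union of rotating wheels (`s` is a bijection), `<` is a
strict partial order, `∼` is a symmetric graph relation, `<` and `∼` relate only elements
of different wheels, any two distinct wheels are comparable elementwise under `<`, and `∼`
is compatible with the successor operation. -/
def IsRotatingMachine (M : Type) [rotLang.Structure M] : Prop :=
  Function.Bijective (rotS (M := M)) ∧
  (∀ x : M, ¬ rotLt x x) ∧
  (∀ x y z : M, rotLt x y → rotLt y z → rotLt x z) ∧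
  (∀ x y : M, rotSim x y → rotSim y x) ∧
  (∀ x y : M, rotLt x y ∨ rotSim x y → ¬ rotSameWheel x y) ∧
  (∀ x y : M, ¬ rotSameWheel x y →
    (∀ a b : M, rotSameWheel a x → rotSameWheel b y → rotLt a b) ∨
    (∀ a b : M, rotSameWheel a x → rotSameWheel b y → rotLt b a)) ∧
  (∀ x y : M, rotSim x y → rotSim (rotS x) (rotS y))

/-- The class of all (finite) rotating machines. -/
def rotClass : Set (Bundled.{0} rotLang.Structure) :=
  {M | Finite M ∧ IsRotatingMachine M}

/-- The `rotLang`-structure with prescribed successor operation and relations. -/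
abbrev rotStructure {α : Type} (s : α → α) (lt sim : α → α → Prop) : rotLang.Structure α where
  funMap {n} f x := match n, f, x with
    | 0, f, _ => Empty.elim f
    | 1, _, x => s (x 0)
    | (_ + 2), f, _ => Empty.elim f
  RelMap {n} r x := match n, r, x with
    | 0, r, _ => Empty.elim r
    | 1, r, _ => Empty.elim r
    | 2, r, x => match (r : Bool) with
      | true => lt (x 0) (x 1)
      | false => sim (x 0) (x 1)
    | (_ + 3), r, _ => Empty.elim r

section

variable {M N : Type} [rotLang.Structure M] [rotLang.Structure N]

/-- An injective map respecting the successor and both relations is an embedding. -/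
def rotEmbedding (f : M → N) (hf : Function.Injective f) (hs : ∀ x, f (rotS x) = rotS (f x))
    (hlt : ∀ x y, rotLt (f x) (f y) ↔ rotLt x y)
    (hsim : ∀ x y, rotSim (f x) (f y) ↔ rotSim x y) : M ↪[rotLang] N where
  toFun := f
  inj' := hf
  map_fun' {n} c x := match n, c, x with
    | 0, c, _ => Empty.elim c
    | 1, (), x => by
      rw [show f ∘ x = ![f (x 0)] by ext i; fin_cases i; rfl]
      conv_lhs => rw [show x = ![x 0] by ext i; fin_cases i; rfl]
      exact hs (x 0)
    | (_ + 2), c, _ => Empty.elim c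
  map_rel' {n} r x := match n, r, x with
    | 0, r, _ => Empty.elim r
    | 1, r, _ => Empty.elim r
    | 2, r, x => by
      rw [show f ∘ x = ![f (x 0), f (x 1)] by ext i; fin_cases i <;> rfl]
      conv_rhs => rw [show x = ![x 0, x 1] by ext i; fin_cases i <;> rfl]
      match (r : Bool) with
      | true => exact hlt (x 0) (x 1)
      | false => exact hsim (x 0) (x 1)
    | (_ + 3), r, _ => Empty.elim r

theorem rotEmbedding_map_rotS (f : M ↪[rotLang] N) (x : M) : f (rotS x) = rotS (f x) := by
  refine (f.map_fun (n := 1) (() : Unit) ![x]).trans (congrArg _ ?_)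
  ext i; fin_cases i; rfl

theorem rotEmbedding_map_rotLt (f : M ↪[rotLang] N) (x y : M) :
    rotLt (f x) (f y) ↔ rotLt x y := by
  rw [rotLt, show ![f x, f y] = f ∘ ![x, y] by ext i; fin_cases i <;> rfl]
  exact f.map_rel (n := 2) (true : Bool) ![x, y]

theorem rotEmbedding_map_rotSim (f : M ↪[rotLang] N) (x y : M) :
    rotSim (f x) (f y) ↔ rotSim x y := by
  rw [rotSim, show ![f x, f y] = f ∘ ![x, y] by ext i; fin_cases i <;> rfl]
  exact f.map_rel (n := 2) (false : Bool) ![x, y]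

theorem map_rotS_iterate {f : M → N} (hs : ∀ x, f (rotS x) = rotS (f x)) (k : ℕ) (x : M) :
    f (rotS^[k] x) = rotS^[k] (f x) :=
  Function.Semiconj.iterate_right hs k x

theorem rotSameWheel_map_iff {f : M → N} (hf : Function.Injective f)
    (hs : ∀ x, f (rotS x) = rotS (f x)) (x y : M) :
    rotSameWheel (f x) (f y) ↔ rotSameWheel x y := by
  simp only [rotSameWheel, ← map_rotS_iterate hs, hf.eq_iff]

theorem rotSameWheel.symm [Finite M] (h : Function.Injective (rotS (M := M))) {x y : M}
    (hxy : rotSameWheel x y) : rotSameWheel y x := by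
  obtain ⟨k, rfl⟩ := hxy
  obtain ⟨n, hn, hx⟩ := Function.Injective.mem_periodicPts h x
  refine ⟨n * k - k, ?_⟩
  rw [← Function.iterate_add_apply, Nat.sub_add_cancel (Nat.le_mul_of_pos_left k hn)]
  exact (hx.mul_const k : _)

/-- A finite structure is a rotating machine iff `s` is injective, `<` is a strict weak order whose
incomparability classes are the wheels, and `∼` is an `s`-invariant symmetric relation between
different wheels. -/
theorem isRotatingMachine_iff [Finite M] : IsRotatingMachine M ↔
    Function.Injective (rotS (M := M)) ∧ (∀ x y : M, rotLt x y → ¬ rotLt y x) ∧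
    (∀ x y z : M, rotLt x y → rotLt x z ∨ rotLt z y) ∧
    (∀ x y : M, rotSameWheel x y ↔ ¬ rotLt x y ∧ ¬ rotLt y x) ∧
    (∀ x y : M, rotSim x y → rotSim y x) ∧
    (∀ x y : M, rotSim x y → ¬ rotSameWheel x y) ∧
    (∀ x y : M, rotSim x y → rotSim (rotS x) (rotS y)) := by
  have refl (x : M) : rotSameWheel x x := ⟨0, rfl⟩
  constructor
  · rintro ⟨hs, hirr, htr, hsymm, hne, hcomp, hinv⟩
    refine ⟨hs.1, fun x y h h' => hirr x (htr _ _ _ h h'), fun x y z h => ?_, fun x y => ?_, hsymm,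
      fun x y h => hne x y (Or.inr h), hinv⟩
    · by_cases hxz : rotSameWheel x z
      · rcases hcomp x y (hne x y (Or.inl h)) with h' | h'
        · exact Or.inr (h' z y (hxz.symm hs.1) (refl y))
        · exact (hirr x (htr _ _ _ h (h' x y (refl x) (refl y)))).elim
      · rcases hcomp x z hxz with h' | h'
        · exact Or.inl (h' x z (refl x) (refl z))
        · exact Or.inr (htr _ _ _ (h' x z (refl x) (refl z)) h)
    · refine ⟨fun h => ⟨fun h' => hne x y (Or.inl h') h,
        fun h' => hne y x (Or.inl h') (h.symm hs.1)⟩, fun h => ?_⟩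
      by_contra hxy
      rcases hcomp x y hxy with h' | h'
      · exact h.1 (h' x y (refl x) (refl y))
      · exact h.2 (h' x y (refl x) (refl y))
  · rintro ⟨hs, hasymm, hneg, hwheel, hsymm, hne, hinv⟩
    refine ⟨Finite.injective_iff_bijective.1 hs, fun x h => hasymm x x h h,
      fun x y z h h' => (hneg x y z h).resolve_right (hasymm y z h'), hsymm, ?_, ?_, hinv⟩
    · rintro x y (h | h)
      · exact fun h' => ((hwheel x y).1 h').1 h
      · exact hne x y h
    · have key (x y : M) (h : rotLt x y) (a b : M) (ha : rotSameWheel a x)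
          (hb : rotSameWheel b y) : rotLt a b :=
        (hneg a y b ((hneg x y a h).resolve_left ((hwheel a x).1 ha).2)).resolve_right
          ((hwheel b y).1 hb).1
      intro x y hxy
      rw [hwheel, ← not_or, not_not] at hxy
      exact hxy.imp (key x y) fun h a b ha hb => key y x h b a hb ha

theorem IsRotatingMachine.of_embedding [Finite N] (h : IsRotatingMachine N) (f : M ↪[rotLang] N) :
    IsRotatingMachine M := by
  have := Finite.of_injective f f.injective
  have hs := rotEmbedding_map_rotS f
  have hlt := rotEmbedding_map_rotLt f
  have hsim := rotEmbedding_map_rotSim f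
  have hwheel := rotSameWheel_map_iff f.injective hs
  rw [isRotatingMachine_iff] at h ⊢
  simp only [← hlt, ← hsim, ← hwheel, hs]
  refine ⟨fun x y hxy => f.injective (h.1 ?_), fun _ _ => h.2.1 _ _, fun _ _ _ => h.2.2.1 _ _ _,
    fun _ _ => h.2.2.2.1 _ _, fun _ _ => h.2.2.2.2.1 _ _, fun _ _ => h.2.2.2.2.2.1 _ _,
    fun _ _ => h.2.2.2.2.2.2 _ _⟩
  rw [← hs, ← hs, hxy]

end

theorem countable_quotient_of_finite (K : Set (Bundled.{0} rotLang.Structure))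
    (hK : ∀ M ∈ K, Finite M) : (Quotient.mk' '' K).Countable := by
  let F : (Σ n : ℕ, (Fin n → Fin n) × (Fin n → Fin n → Prop) × (Fin n → Fin n → Prop)) →
      _root_.Quotient (equivSetoid (L := rotLang)) := fun t =>
    Quotient.mk' ⟨Fin t.1, rotStructure t.2.1 t.2.2.1 t.2.2.2⟩
  refine (Set.countable_range F).mono ?_
  rintro _ ⟨M, hM, rfl⟩
  have := hK M hM
  obtain ⟨n, ⟨e⟩⟩ := Finite.exists_equiv_fin M
  let s : Fin n → Fin n := fun x => e (rotS (e.symm x))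
  let lt : Fin n → Fin n → Prop := fun x y => rotLt (e.symm x) (e.symm y)
  let sim : Fin n → Fin n → Prop := fun x y => rotSim (e.symm x) (e.symm y)
  refine ⟨⟨n, s, lt, sim⟩, Quotient.sound ?_⟩
  let _ : rotLang.Structure (Fin n) := rotStructure s lt sim
  let f : Fin n ↪[rotLang] M := rotEmbedding e.symm e.symm.injective
    (fun x => e.symm_apply_apply _) (fun _ _ => Iff.rfl) (fun _ _ => Iff.rfl)
  exact ⟨⟨e.symm, f.map_fun', f.map_rel'⟩⟩

/-- In the amalgam of two machines over a common part, new wheels of the second machine are placed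
below the new wheels of the first machine lying in the same cut of the common part. -/
def amalgLt {M N P : Type} [rotLang.Structure N] [rotLang.Structure P] (f : M → N) (g : M → P) :
    N ⊕ {p : P // p ∉ Set.range g} → N ⊕ {p : P // p ∉ Set.range g} → Prop
  | .inl x, .inl y => rotLt x y
  | .inr x, .inr y => rotLt x.1 y.1
  | .inl x, .inr y => ∃ m, ¬ rotLt (f m) x ∧ rotLt (g m) y.1
  | .inr x, .inl y => ¬ ∃ m, ¬ rotLt (f m) y ∧ rotLt (g m) x.1

/-- The graph relation of the free amalgam of two machines over a common part. -/
def amalgSim {M N P : Type} [rotLang.Structure N] [rotLang.Structure P] (f : M → N) (g : M → P) :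
    N ⊕ {p : P // p ∉ Set.range g} → N ⊕ {p : P // p ∉ Set.range g} → Prop
  | .inl x, .inl y => rotSim x y
  | .inr x, .inr y => rotSim x.1 y.1
  | .inl x, .inr y => ∃ m, f m = x ∧ rotSim (g m) y.1
  | .inr x, .inl y => ∃ m, f m = y ∧ rotSim (g m) x.1

section Amalgamation

variable {M N P : Type} [rotLang.Structure M] [rotLang.Structure N] [rotLang.Structure P]

theorem rotSameWheel.mem_range [Finite P] (hP : Function.Injective (rotS (M := P)))
    (g : M ↪[rotLang] P) {x y : P} (h : rotSameWheel x y) (hy : y ∈ Set.range g) :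
    x ∈ Set.range g := by
  obtain ⟨m, rfl⟩ := hy
  obtain ⟨k, hk⟩ := h.symm hP
  exact ⟨_, (map_rotS_iterate (rotEmbedding_map_rotS g) k m).trans hk⟩

theorem exists_amalgam [Finite N] [Finite P] (hN : IsRotatingMachine N) (hP : IsRotatingMachine P)
    (f : M ↪[rotLang] N) (g : M ↪[rotLang] P) :
    ∃ (Q : Bundled.{0} rotLang.Structure) (NQ : N ↪[rotLang] Q) (PQ : P ↪[rotLang] Q),
      Q ∈ rotClass ∧ NQ.comp f = PQ.comp g := by
  classical
  rw [isRotatingMachine_iff] at hN hP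
  obtain ⟨hNs, hNasymm, hNneg, hNwheel, hNsymm, hNne, hNinv⟩ := hN
  obtain ⟨hPs, hPasymm, hPneg, hPwheel, hPsymm, hPne, hPinv⟩ := hP
  have hfs := rotEmbedding_map_rotS f
  have hflt := rotEmbedding_map_rotLt f
  have hfsim := rotEmbedding_map_rotSim f
  have hgs := rotEmbedding_map_rotS g
  have hglt := rotEmbedding_map_rotLt g
  have hgsim := rotEmbedding_map_rotSim g
  let s : N ⊕ {p : P // p ∉ Set.range g} → N ⊕ {p : P // p ∉ Set.range g} :=
    Sum.map rotS fun p => ⟨rotS p.1, fun h => p.2 (rotSameWheel.mem_range hPs g ⟨1, rfl⟩ h)⟩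
  let _ : rotLang.Structure (N ⊕ {p : P // p ∉ Set.range g}) :=
    rotStructure s (amalgLt f g) (amalgSim f g)
  have hcmp (m : M) (p : P) (hp : p ∉ Set.range g) : rotLt (g m) p ∨ rotLt p (g m) := by
    by_contra h
    exact hp (rotSameWheel.mem_range hPs g ((hPwheel p (g m)).2 (by tauto)) ⟨m, rfl⟩)
  let toQ : P → N ⊕ {p : P // p ∉ Set.range g} := fun p =>
    if h : p ∈ Set.range g then .inl (f h.choose) else .inr ⟨p, h⟩
  have toQ_g (m : M) : toQ (g m) = .inl (f m) := by
    have h : g m ∈ Set.range g := ⟨m, rfl⟩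
    simp only [toQ, dif_pos h]
    rw [g.injective h.choose_spec]
  have toQ_of_notMem (p : P) (h : p ∉ Set.range g) : toQ p = .inr ⟨p, h⟩ := dif_neg h
  have hiter (k : ℕ) (p : {p : P // p ∉ Set.range g}) :
      ∃ q, rotS^[k] (Sum.inr p : N ⊕ {p : P // p ∉ Set.range g}) = .inr q ∧ q.1 = rotS^[k] p.1 := by
    induction k with
    | zero => exact ⟨p, rfl, rfl⟩
    | succ k ih =>
      obtain ⟨q, hq, hq'⟩ := ih
      rw [Function.iterate_succ_apply', Function.iterate_succ_apply', hq, ← hq']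
      exact ⟨_, rfl, rfl⟩
  have hll (x y : N) : rotSameWheel (.inl x : N ⊕ {p : P // p ∉ Set.range g}) (.inl y) ↔
      rotSameWheel x y := rotSameWheel_map_iff Sum.inl_injective (fun _ => rfl) x y
  have hlr (x : N) (y) : ¬ rotSameWheel (.inl x : N ⊕ {p : P // p ∉ Set.range g}) (.inr y) := by
    rintro ⟨k, hk⟩
    rw [← map_rotS_iterate (f := Sum.inl) (fun _ => rfl)] at hk
    cases hk
  have hrl (x) (y : N) : ¬ rotSameWheel (.inr x : N ⊕ {p : P // p ∉ Set.range g}) (.inl y) := by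
    rintro ⟨k, hk⟩
    obtain ⟨q, hq, -⟩ := hiter k x
    rw [hq] at hk
    cases hk
  have hrr (x y) : rotSameWheel (.inr x : N ⊕ {p : P // p ∉ Set.range g}) (.inr y) ↔
      rotSameWheel x.1 y.1 := by
    refine exists_congr fun k => ?_
    obtain ⟨q, hq, hq'⟩ := hiter k x
    rw [hq, ← hq', Sum.inr.injEq, Subtype.ext_iff]
  refine ⟨⟨N ⊕ {p : P // p ∉ Set.range g}, inferInstance⟩,
    rotEmbedding Sum.inl Sum.inl_injective (fun _ => rfl) (fun _ _ => Iff.rfl) (fun _ _ => Iff.rfl),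
    rotEmbedding toQ ?_ ?_ ?_ ?_, ⟨inferInstanceAs (Finite (_ ⊕ _)), ?_⟩, ?_⟩
  · intro x y hxy
    by_cases hx : x ∈ Set.range g <;> by_cases hy : y ∈ Set.range g
    · obtain ⟨a, rfl⟩ := hx
      obtain ⟨b, rfl⟩ := hy
      rw [toQ_g, toQ_g, Sum.inl.injEq] at hxy
      rw [f.injective hxy]
    · obtain ⟨a, rfl⟩ := hx
      rw [toQ_g, toQ_of_notMem y hy] at hxy
      cases hxy
    · obtain ⟨b, rfl⟩ := hy
      rw [toQ_g, toQ_of_notMem x hx] at hxy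
      cases hxy
    · rw [toQ_of_notMem x hx, toQ_of_notMem y hy] at hxy
      exact congrArg Subtype.val (Sum.inr_injective hxy)
  · intro x
    by_cases hx : x ∈ Set.range g
    · obtain ⟨a, rfl⟩ := hx
      rw [← hgs, toQ_g, toQ_g, hfs]
      rfl
    · rw [toQ_of_notMem x hx, toQ_of_notMem (rotS x)
        fun h => hx (rotSameWheel.mem_range hPs g ⟨1, rfl⟩ h)]
      rfl
  · intro x y
    change amalgLt f g _ _ ↔ _
    by_cases hx : x ∈ Set.range g <;> by_cases hy : y ∈ Set.range g
    · obtain ⟨a, rfl⟩ := hx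
      obtain ⟨b, rfl⟩ := hy
      rw [toQ_g, toQ_g, hglt]
      exact hflt a b
    · obtain ⟨a, rfl⟩ := hx
      rw [toQ_g, toQ_of_notMem y hy]
      refine ⟨fun ⟨m, hm, hm'⟩ => ?_, fun h => ⟨a, fun h' => hNasymm _ _ h' h', h⟩⟩
      rw [hflt, ← hglt] at hm
      exact (hPneg _ _ (g a) hm').resolve_left hm
    · obtain ⟨b, rfl⟩ := hy
      rw [toQ_g, toQ_of_notMem x hx]
      refine ⟨fun h => (hcmp b x hx).resolve_left
        fun h' => h ⟨b, fun h' => hNasymm _ _ h' h', h'⟩, fun h => ?_⟩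
      rintro ⟨m, hm, hm'⟩
      rw [hflt, ← hglt] at hm
      exact hPasymm _ _ h ((hPneg _ _ (g b) hm').resolve_left hm)
    · rw [toQ_of_notMem x hx, toQ_of_notMem y hy]
      rfl
  · intro x y
    change amalgSim f g _ _ ↔ _
    by_cases hx : x ∈ Set.range g <;> by_cases hy : y ∈ Set.range g
    · obtain ⟨a, rfl⟩ := hx
      obtain ⟨b, rfl⟩ := hy
      rw [toQ_g, toQ_g, hgsim]
      exact hfsim a b
    · obtain ⟨a, rfl⟩ := hx
      rw [toQ_g, toQ_of_notMem y hy]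
      refine ⟨fun ⟨m, hm, hm'⟩ => ?_, fun h => ⟨a, rfl, h⟩⟩
      rwa [← f.injective hm]
    · obtain ⟨b, rfl⟩ := hy
      rw [toQ_g, toQ_of_notMem x hx]
      refine ⟨fun ⟨m, hm, hm'⟩ => ?_, fun h => ⟨b, rfl, hPsymm _ _ h⟩⟩
      rw [← f.injective hm]
      exact hPsymm _ _ hm'
    · rw [toQ_of_notMem x hx, toQ_of_notMem y hy]
      rfl
  · refine isRotatingMachine_iff.2 ⟨?_, ?_, ?_, ?_, ?_, ?_, ?_⟩
    · exact hNs.sumMap fun x y h => Subtype.ext (hPs (congrArg Subtype.val h))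
    · rintro (x | x) (y | y) h h'
      · exact hNasymm x y h h'
      · exact h' h
      · exact h h'
      · exact hPasymm x.1 y.1 h h'
    · rintro (x | x) (y | y) (z | z) h
      · exact hNneg x y z h
      · by_cases h' : ∃ m, ¬ rotLt (f m) x ∧ rotLt (g m) z.1
        · exact Or.inl h'
        · refine Or.inr ?_
          rintro ⟨m, hm, hm'⟩
          exact h' ⟨m, fun hx => hm ((hNneg _ _ y hx).resolve_right
            (hNasymm _ _ h)), hm'⟩
      · obtain ⟨m, hm, hm'⟩ := h
        by_cases h' : rotLt x z
        · exact Or.inl h'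
        · refine Or.inr ⟨m, fun hz => ?_, hm'⟩
          exact (hNneg _ _ x hz).elim hm h'
      · obtain ⟨m, hm, hm'⟩ := h
        exact (hPneg _ _ z.1 hm').imp (fun h' => ⟨m, hm, h'⟩) id
      · by_cases h' : ∃ m, ¬ rotLt (f m) z ∧ rotLt (g m) x.1
        · refine Or.inr ?_
          obtain ⟨m, hm, hm'⟩ := h'
          have hy : rotLt (f m) y := by
            by_contra hy
            exact h ⟨m, hy, hm'⟩
          exact (hNneg _ _ z hy).resolve_left hm
        · exact Or.inl h'
      · by_cases h' : ∃ m, ¬ rotLt (f m) y ∧ rotLt (g m) z.1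
        · refine Or.inl ?_
          obtain ⟨m, hm, hm'⟩ := h'
          have hx : ¬ rotLt (g m) x.1 := fun hx => h ⟨m, hm, hx⟩
          exact (hPneg _ _ x.1 hm').resolve_left hx
        · exact Or.inr h'
      · by_cases h' : ∃ m, ¬ rotLt (f m) z ∧ rotLt (g m) x.1
        · obtain ⟨m, hm, hm'⟩ := h'
          refine Or.inr ⟨m, hm, ?_⟩
          exact (hPneg _ _ y.1 hm').resolve_right (hPasymm _ _ h)
        · exact Or.inl h'
      · exact hPneg x.1 y.1 z.1 h
    · rintro (x | x) (y | y)
      · exact (hll x y).trans (hNwheel x y)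
      · exact iff_of_false (hlr x y) fun h => h.2 h.1
      · exact iff_of_false (hrl x y) fun h => h.1 h.2
      · exact (hrr x y).trans (hPwheel x.1 y.1)
    · rintro (x | x) (y | y) h
      · exact hNsymm x y h
      · exact h
      · exact h
      · exact hPsymm x.1 y.1 h
    · rintro (x | x) (y | y) h
      · exact mt (hll x y).1 (hNne x y h)
      · exact hlr x y
      · exact hrl x y
      · exact mt (hrr x y).1 (hPne x.1 y.1 h)
    · rintro (x | x) (y | y) h
      · exact hNinv x y h
      · obtain ⟨m, rfl, hm⟩ := h
        exact ⟨rotS m, hfs m, hgs m ▸ hPinv _ _ hm⟩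
      · obtain ⟨m, rfl, hm⟩ := h
        exact ⟨rotS m, hfs m, hgs m ▸ hPinv _ _ hm⟩
      · exact hPinv x.1 y.1 h
  · ext m
    exact (toQ_g m).symm

end Amalgamation

/-- The class of all rotating machines is a Fraïssé class of finite structures. -/
theorem statement17 :
    (∀ M ∈ rotClass, Finite M) ∧ FirstOrder.Language.IsFraisse rotClass := by
  let _ : rotLang.Structure Empty := rotStructure id (fun _ _ => False) (fun _ _ => False)
  have hEmpty : IsRotatingMachine Empty := by
    rw [isRotatingMachine_iff]
    exact ⟨fun x => x.elim, fun x => x.elim, fun x => x.elim, fun x => x.elim, fun x => x.elim,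
      fun x => x.elim, fun x => x.elim⟩
  have fromEmpty (N : Bundled.{0} rotLang.Structure) : Empty ↪[rotLang] N :=
    rotEmbedding Empty.elim (fun x => x.elim) (fun x => x.elim) (fun x => x.elim) fun x => x.elim
  refine ⟨fun M hM => hM.1, ⟨⟨Empty, inferInstance⟩, inferInstanceAs (Finite Empty), hEmpty⟩, ?_,
    countable_quotient_of_finite _ fun M hM => hM.1, ?_, ?_, ?_⟩
  · intro M hM
    have := hM.1
    exact Structure.fg_iff.2 ⟨Set.univ, Set.toFinite _, Substructure.closure_univ⟩
  · rintro M ⟨hfin, hM⟩ N ⟨-, ⟨f⟩⟩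
    exact ⟨Finite.of_injective f f.injective, hM.of_embedding f⟩
  · rintro N ⟨_, hN⟩ P ⟨_, hP⟩
    obtain ⟨Q, NQ, PQ, hQ, -⟩ := exists_amalgam hN hP (fromEmpty N) (fromEmpty P)
    exact ⟨Q, hQ, ⟨NQ⟩, ⟨PQ⟩⟩
  · rintro M N P MN MP - ⟨_, hN⟩ ⟨_, hP⟩
    exact exists_amalgam hN hP MN MP
end

section
/- For every rotating machine M, the group Aut(M) is abelian (it embeds into the product of the automorphism groups of its rotating wheels, each of which is a finite cyclic group generated by the successor operation, of order equal to the size of the wheel). Moreover, every finite product of finite cyclic groups is isomorphic to Aut(M) for some rotating machine M with empty edge relation ∼. -/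
open FirstOrder CategoryTheory FirstOrder.Language

/-- The automorphism group of a first-order structure, with multiplication given by
composition of automorphisms. -/
instance autGroup {L : FirstOrder.Language} {M : Type*} [L.Structure M] :
    Group (M ≃[L] M) where
  mul f g := f.comp g
  one := FirstOrder.Language.Equiv.refl L M
  inv f := f.symm
  mul_assoc _ _ _ := rfl
  one_mul := FirstOrder.Language.Equiv.refl_comp
  mul_one := FirstOrder.Language.Equiv.comp_refl
  inv_mul_cancel := FirstOrder.Language.Equiv.symm_comp_self

section Automorphisms

variable {M : Type} [rotLang.Structure M]

theorem rotEquiv_map_rotS (f : M ≃[rotLang] M) (x : M) : f (rotS x) = rotS (f x) := by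
  have h := f.map_fun (n := 1) (() : Unit) ![x]
  refine h.trans ?_
  unfold rotS
  congr 1
  funext i
  fin_cases i
  rfl

theorem rotEquiv_map_iterate_rotS (f : M ≃[rotLang] M) (k : ℕ) (x : M) :
    f (rotS^[k] x) = rotS^[k] (f x) :=
  (Function.Semiconj.iterate_right (f := f) (rotEquiv_map_rotS f) k) x

theorem rotEquiv_map_rotLt (f : M ≃[rotLang] M) {x y : M} (h : rotLt x y) :
    rotLt (f x) (f y) := by
  have h' := (f.map_rel (n := 2) (true : Bool) ![x, y]).2 h
  unfold rotLt
  convert h' using 1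
  funext i
  fin_cases i <;> rfl

/-- An injective relation-preserving self-map of a finite type never moves a point along a
transitive irreflexive relation. -/
theorem not_rel_apply_self_of_finite {α : Type*} [Finite α] {r : α → α → Prop}
    (irrefl : ∀ x, ¬ r x x) (trans : ∀ x y z, r x y → r y z → r x z) {f : α → α}
    (inj : Function.Injective f) (mono : ∀ x y, r x y → r (f x) (f y)) (x : α) :
    ¬ r x (f x) := by
  intro h
  have step : ∀ k : ℕ, r (f^[k] x) (f^[k + 1] x) := by
    intro k
    induction k with
    | zero => exact h
    | succ k ih =>
      simpa only [Function.iterate_succ_apply'] using mono _ _ ih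
  have chain : ∀ k : ℕ, r x (f^[k + 1] x) := by
    intro k
    induction k with
    | zero => exact h
    | succ k ih => exact trans _ _ _ ih (step (k + 1))
  obtain ⟨m, hm, hper⟩ := Function.mem_periodicPts.1 (inj.mem_periodicPts x)
  obtain ⟨k, rfl⟩ := Nat.exists_eq_succ_of_ne_zero hm.ne'
  exact irrefl x ((congrArg (r x) hper.eq).mp (chain k))

/-- Every automorphism of a finite rotating machine preserves each wheel. -/
theorem IsRotatingMachine.rotSameWheel_apply [Finite M] (hM : IsRotatingMachine M)
    (f : M ≃[rotLang] M) (x : M) : rotSameWheel x (f x) := by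
  obtain ⟨-, irrefl, trans, -, -, comparable, -⟩ := hM
  by_contra hne
  have self : ∀ y : M, rotSameWheel y y := fun y => ⟨0, rfl⟩
  rcases comparable x (f x) hne with h | h
  · exact not_rel_apply_self_of_finite irrefl trans f.injective
      (fun _ _ => rotEquiv_map_rotLt f) x (h _ _ (self _) (self _))
  · exact not_rel_apply_self_of_finite (r := fun a b : M => rotLt b a) irrefl
      (fun a b c hab hbc => trans c b a hbc hab) f.injective
      (fun _ _ => rotEquiv_map_rotLt f) x (h _ _ (self _) (self _))

theorem IsRotatingMachine.aut_mul_comm [Finite M] (hM : IsRotatingMachine M)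
    (f g : M ≃[rotLang] M) : f * g = g * f := by
  ext x
  change f (g x) = g (f x)
  obtain ⟨k, hk⟩ := hM.rotSameWheel_apply f x
  obtain ⟨l, hl⟩ := hM.rotSameWheel_apply g x
  rw [← hk, ← hl, rotEquiv_map_iterate_rotS, rotEquiv_map_iterate_rotS, ← hk, ← hl,
    ← Function.iterate_add_apply, ← Function.iterate_add_apply, add_comm]

end Automorphisms

section WheelSum

/-- The disjoint union of wheels of sizes `n i`. -/
structure WheelSum {k : ℕ} (n : Fin k → ℕ) : Type where
  /-- The index of the wheel. -/
  idx : Fin k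
  /-- The position on the wheel. -/
  pos : ZMod (n idx)

variable {k : ℕ} {n : Fin k → ℕ}

/-- Wheels are ordered by their indices, the successor adds one in each wheel, and the edge
relation is empty. -/
instance : rotLang.Structure (WheelSum n) where
  funMap {m} := match m with
    | 0 => fun c _ => Empty.elim c
    | 1 => fun _ v => ⟨(v 0).idx, (v 0).pos + 1⟩
    | (_ + 2) => fun c _ => Empty.elim c
  RelMap {m} := match m with
    | 0 => fun c _ => Empty.elim c
    | 1 => fun c _ => Empty.elim c
    | 2 => fun (b : Bool) v => b = true ∧ (v 0).idx < (v 1).idx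
    | (_ + 3) => fun c _ => Empty.elim c

namespace WheelSum

theorem rotS_mk (i : Fin k) (a : ZMod (n i)) :
    rotS (M := WheelSum n) ⟨i, a⟩ = ⟨i, a + 1⟩ := rfl

theorem rotLt_iff (x y : WheelSum n) : rotLt x y ↔ x.idx < y.idx :=
  ⟨fun h => h.2, fun h => ⟨rfl, h⟩⟩

theorem not_rotSim (x y : WheelSum n) : ¬ rotSim x y :=
  fun h => Bool.false_ne_true h.1

theorem iterate_rotS_mk (m : ℕ) (i : Fin k) (a : ZMod (n i)) :
    rotS^[m] (⟨i, a⟩ : WheelSum n) = ⟨i, a + m⟩ := by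
  induction m with
  | zero => simp
  | succ m ih => rw [Function.iterate_succ_apply', ih, rotS_mk, Nat.cast_succ, add_assoc]

theorem rotSameWheel_iff [∀ i, NeZero (n i)] (x y : WheelSum n) :
    rotSameWheel x y ↔ x.idx = y.idx := by
  obtain ⟨i, a⟩ := x
  obtain ⟨j, b⟩ := y
  constructor
  · rintro ⟨m, hm⟩
    rw [iterate_rotS_mk] at hm
    exact (mk.inj hm).1
  · rintro h
    obtain rfl : i = j := h
    refine ⟨(b - a).val, ?_⟩
    rw [iterate_rotS_mk, ZMod.natCast_zmod_val, add_sub_cancel]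

/-- Rotate the `i`-th wheel by `c i`. -/
def rotate (c : ∀ i, Multiplicative (ZMod (n i))) : WheelSum n ≃[rotLang] WheelSum n where
  toFun x := ⟨x.idx, (c x.idx).toAdd + x.pos⟩
  invFun x := ⟨x.idx, -(c x.idx).toAdd + x.pos⟩
  left_inv := by rintro ⟨i, a⟩; simp
  right_inv := by rintro ⟨i, a⟩; simp
  map_fun' {m} g v := match m, g with
    | 0, g => Empty.elim g
    | 1, _ => congrArg (WheelSum.mk (v 0).idx) (add_assoc _ _ _).symm
    | (_ + 2), g => Empty.elim g
  map_rel' {m} r v := match m, r with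
    | 0, r => Empty.elim r
    | 1, r => Empty.elim r
    | 2, _ => Iff.rfl
    | (_ + 3), r => Empty.elim r

theorem rotate_mk (c : ∀ i, Multiplicative (ZMod (n i))) (i : Fin k) (a : ZMod (n i)) :
    rotate c ⟨i, a⟩ = ⟨i, (c i).toAdd + a⟩ := rfl

/-- Rotation of the wheels as a homomorphism to the automorphism group. -/
def rotateHom : (∀ i, Multiplicative (ZMod (n i))) →* (WheelSum n ≃[rotLang] WheelSum n) :=
  MonoidHom.mk' rotate fun c d => by
    ext ⟨i, a⟩
    exact congrArg (WheelSum.mk i) (add_assoc _ _ _)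

variable [∀ i, NeZero (n i)]

instance : Finite (WheelSum n) :=
  Finite.of_surjective (fun x : Σ i, ZMod (n i) => ⟨x.1, x.2⟩) fun ⟨i, a⟩ => ⟨⟨i, a⟩, rfl⟩

theorem isRotatingMachine : IsRotatingMachine (WheelSum n) := by
  refine ⟨⟨?_, ?_⟩, ?_, ?_, ?_, ?_, ?_, ?_⟩
  · rintro ⟨i, a⟩ ⟨j, b⟩ h
    rw [rotS_mk, rotS_mk] at h
    obtain rfl : i = j := congrArg idx h
    rw [add_right_cancel (eq_of_heq (mk.inj h).2)]
  · rintro ⟨i, a⟩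
    exact ⟨⟨i, a - 1⟩, by rw [rotS_mk, sub_add_cancel]⟩
  · intro x
    simp [rotLt_iff]
  · intro x y z
    simpa only [rotLt_iff] using lt_trans
  · exact fun x y h => (not_rotSim x y h).elim
  · rintro x y (h | h)
    · rw [rotSameWheel_iff]
      exact ((rotLt_iff x y).1 h).ne
    · exact (not_rotSim x y h).elim
  · intro x y h
    simp only [rotSameWheel_iff, rotLt_iff] at h ⊢
    rcases lt_or_gt_of_ne h with h | h
    · exact Or.inl fun a b ha hb => by rwa [ha, hb]
    · exact Or.inr fun a b ha hb => by rwa [ha, hb]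
  · exact fun x y h => (not_rotSim x y h).elim

theorem rotateHom_bijective : Function.Bijective (rotateHom (n := n)) := by
  constructor
  · intro c d h
    funext i
    have h0 : rotate c ⟨i, 0⟩ = rotate d ⟨i, 0⟩ := congrArg (fun f => f ⟨i, 0⟩) h
    rw [rotate_mk, rotate_mk] at h0
    exact add_right_cancel (G := ZMod (n i)) (eq_of_heq (mk.inj h0).2)
  · intro f
    choose m hm using fun i => isRotatingMachine.rotSameWheel_apply f ⟨i, 0⟩
    refine ⟨fun i => Multiplicative.ofAdd (m i : ZMod (n i)), ?_⟩
    ext ⟨i, a⟩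
    have ha : (⟨i, a⟩ : WheelSum n) = rotS^[a.val] ⟨i, 0⟩ := by
      rw [iterate_rotS_mk, zero_add, ZMod.natCast_zmod_val]
    change rotate _ _ = _
    rw [rotate_mk, toAdd_ofAdd, ha, rotEquiv_map_iterate_rotS, ← hm, iterate_rotS_mk,
      iterate_rotS_mk, zero_add, ZMod.natCast_zmod_val]

/-- The automorphism group of a disjoint union of wheels is the product of the cyclic groups of
rotations. -/
noncomputable def autEquiv :
    (WheelSum n ≃[rotLang] WheelSum n) ≃* ∀ i, Multiplicative (ZMod (n i)) :=
  (MulEquiv.ofBijective rotateHom rotateHom_bijective).symm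

end WheelSum

end WheelSum

/-- The automorphism group of every rotating machine is abelian, and every finite product
of finite cyclic groups is isomorphic to the automorphism group of some rotating machine
with empty edge relation `∼`. -/
theorem statement19 :
    (∀ M ∈ rotClass, ∀ f g : M ≃[rotLang] M, f * g = g * f) ∧
    (∀ (k : ℕ) (n : Fin k → ℕ), (∀ i, 0 < n i) →
      ∃ M ∈ rotClass, (∀ x y : M, ¬ rotSim x y) ∧
        Nonempty ((M ≃[rotLang] M) ≃* ∀ i, Multiplicative (ZMod (n i)))) := by
  refine ⟨fun M hM f g => ?_, fun k n hn => ?_⟩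
  · have := hM.1
    exact hM.2.aut_mul_comm f g
  · have : ∀ i, NeZero (n i) := fun i => ⟨(hn i).ne'⟩
    exact ⟨Bundled.of (WheelSum n), ⟨inferInstanceAs (Finite (WheelSum n)),
      WheelSum.isRotatingMachine⟩, WheelSum.not_rotSim, ⟨WheelSum.autEquiv⟩⟩
end
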